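/- arXiv:2108.03143 — 2 statements merged into one kernel-verified Lean document; each statement's English description precedes it below -/
import Mathlib

section
/- Theorem 1 (a-BDMM lower bound). Let S = Ω and for each ω ∈ Ω let ℓ_{ω,1}, …, ℓ_{ω,J} be valid cuts for scenario ω. Let x̄ ∈ ℝ^n, and let multipliers w_s ∈ ℝ^n for s ∈ Ω satisfy Σ_{s∈Ω} p_s w_s = 0. For each s ∈ Ω, suppose ζ_s ∈ ℝ is a lower bound on the s-th Lagrangian master problem, i.e. ζ_s ≤ I·x + Σ_{ω∈Ω} p_ω α_ω + w_s·(x − x̄) for every x ∈ X, α ∈ ℝ^Ω and y_s ∈ Λ_s such that α_ω ≥ 0 and α_ω ≥ ℓ_{ω,j}(x) for all ω ∈ Ω and j = 1, …, J, α_s ≥ c·y_s, and W y_s ≤ T x + h_s. Then for every DE-feasible pair (x, (y_ω)_{ω∈Ω}) one has Σ_{s∈Ω} p_s ζ_s ≤ I·x + Σ_{ω∈Ω} p_ω (c·y_ω); i.e., LB_{a-BDMM} = Σ_{s∈Ω} p_s ζ_s is a valid lower bound on the optimal value of the DE problem. -/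
open Matrix Finset

/-- Theorem 1 (a-BDMM lower bound): with valid Benders cuts `ℓ`, nonnegative
operational costs, and Progressive-Hedging multipliers `w` with zero
probability-weighted mean, any lower bounds `ζ s` on the `s`-th Lagrangian
master problem (with primal cut of scenario `s`) yield the valid lower bound
`∑ s, p s * ζ s` on the objective of every DE-feasible pair. -/
theorem aBDMM_lower_bound
    {n m l : ℕ} {Ω : Type*} [Fintype Ω]
    (p : Ω → ℝ) (hp : ∀ ω, 0 < p ω) (hp1 : ∑ ω, p ω = 1)
    (I : Fin n → ℝ) (c : Fin m → ℝ)
    (W : Matrix (Fin l) (Fin m) ℝ) (T : Matrix (Fin l) (Fin n) ℝ)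
    (h : Ω → Fin l → ℝ)
    (X : Set (Fin n → ℝ)) (Λ : Ω → Set (Fin m → ℝ))
    (J : ℕ) (ℓ : Ω → Fin J → (Fin n → ℝ) → ℝ)
    (haff : ∀ ω j, ∃ (a : Fin n → ℝ) (b : ℝ), ∀ x, ℓ ω j x = a ⬝ᵥ x + b)
    (hcut : ∀ ω j, ∀ x ∈ X, ∀ y ∈ Λ ω,
      W *ᵥ y ≤ T *ᵥ x + h ω → ℓ ω j x ≤ c ⬝ᵥ y)
    (hnonneg : ∀ ω, ∀ y ∈ Λ ω, 0 ≤ c ⬝ᵥ y)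
    (xbar : Fin n → ℝ) (w : Ω → Fin n → ℝ)
    (hw : ∑ s, p s • w s = 0)
    (ζ : Ω → ℝ)
    (hζ : ∀ s, ∀ x ∈ X, ∀ α : Ω → ℝ, ∀ ys ∈ Λ s,
        (∀ ω, 0 ≤ α ω) → (∀ ω j, ℓ ω j x ≤ α ω) →
        c ⬝ᵥ ys ≤ α s → W *ᵥ ys ≤ T *ᵥ x + h s →
        ζ s ≤ I ⬝ᵥ x + (∑ ω, p ω * α ω) + w s ⬝ᵥ (x - xbar))
    (x : Fin n → ℝ) (hx : x ∈ X) (y : Ω → Fin m → ℝ)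
    (hy : ∀ ω, y ω ∈ Λ ω) (hfeas : ∀ ω, W *ᵥ y ω ≤ T *ᵥ x + h ω) :
    ∑ s, p s * ζ s ≤ I ⬝ᵥ x + ∑ ω, p ω * (c ⬝ᵥ y ω) := by
  have hζ' (s : Ω) :
      p s * ζ s ≤ p s * (I ⬝ᵥ x + ∑ ω, p ω * (c ⬝ᵥ y ω)) + (p s • w s) ⬝ᵥ (x - xbar) := by
    rw [smul_dotProduct, smul_eq_mul, ← mul_add]
    exact mul_le_mul_of_nonneg_left
      (hζ s x hx (fun ω => c ⬝ᵥ y ω) (y s) (hy s) (fun ω => hnonneg ω _ (hy ω))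
        (fun ω j => hcut ω j x hx _ (hy ω) (hfeas ω)) le_rfl (hfeas s)) (hp s).le
  refine (Finset.sum_le_sum fun s _ => hζ' s).trans_eq ?_
  rw [Finset.sum_add_distrib, ← Finset.sum_mul, hp1, one_mul, ← sum_dotProduct, hw,
    zero_dotProduct, add_zero]
end

section
/- Validity of the BDMM lower bound (equation LB_BDMM). For each ω ∈ Ω let ℓ_{ω,1}, …, ℓ_{ω,J} be valid cuts for scenario ω, and assume c·y ≥ 0 for every y ∈ Λ_ω and every ω ∈ Ω. For each s ∈ Ω suppose z_s ∈ ℝ is a lower bound on the s-th master problem with primal cut, i.e. z_s ≤ I·x + Σ_{ω∈Ω} p_ω α_ω for every x ∈ X, α ∈ ℝ^Ω and y_s ∈ Λ_s such that α_ω ≥ 0 and α_ω ≥ ℓ_{ω,j}(x) for all ω ∈ Ω and j = 1, …, J, α_s ≥ c·y_s, and W y_s ≤ T x + h_s. Then max_{s∈Ω} z_s ≤ I·x + Σ_{ω∈Ω} p_ω (c·y_ω) for every DE-feasible pair (x, (y_ω)_{ω∈Ω}); i.e., LB_BDMM = max_{s∈Ω} z_s is a valid lower bound on the DE optimal value. 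-/
open Matrix Finset

/-- Validity of the BDMM lower bound `LB_BDMM = max_{s ∈ Ω} z_s`. -/
theorem bdmm_lower_bound
    {n m l : ℕ} {Ω : Type*} [Fintype Ω] [Nonempty Ω]
    (p : Ω → ℝ) (hp : ∀ ω, 0 < p ω) (hp1 : ∑ ω, p ω = 1)
    (I : Fin n → ℝ) (c : Fin m → ℝ)
    (W : Matrix (Fin l) (Fin m) ℝ) (T : Matrix (Fin l) (Fin n) ℝ)
    (h : Ω → Fin l → ℝ)
    (X : Set (Fin n → ℝ)) (Λ : Ω → Set (Fin m → ℝ))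
    (J : ℕ) (ℓ : Ω → Fin J → (Fin n → ℝ) → ℝ)
    (haff : ∀ ω j, ∃ (a : Fin n → ℝ) (b : ℝ), ∀ x, ℓ ω j x = a ⬝ᵥ x + b)
    (hcut : ∀ ω j, ∀ x ∈ X, ∀ y ∈ Λ ω,
      W *ᵥ y ≤ T *ᵥ x + h ω → ℓ ω j x ≤ c ⬝ᵥ y)
    (hnonneg : ∀ ω, ∀ y ∈ Λ ω, 0 ≤ c ⬝ᵥ y)
    (z : Ω → ℝ)
    (hz : ∀ s, ∀ x ∈ X, ∀ α : Ω → ℝ, ∀ ys ∈ Λ s,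
        (∀ ω, 0 ≤ α ω) → (∀ ω j, ℓ ω j x ≤ α ω) →
        c ⬝ᵥ ys ≤ α s → W *ᵥ ys ≤ T *ᵥ x + h s →
        z s ≤ I ⬝ᵥ x + ∑ ω, p ω * α ω)
    (x : Fin n → ℝ) (hx : x ∈ X) (y : Ω → Fin m → ℝ)
    (hy : ∀ ω, y ω ∈ Λ ω) (hfeas : ∀ ω, W *ᵥ y ω ≤ T *ᵥ x + h ω) :
    Finset.univ.sup' Finset.univ_nonempty z
      ≤ I ⬝ᵥ x + ∑ ω, p ω * (c ⬝ᵥ y ω) := by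
  exact Finset.sup'_le _ _ fun s _ =>
    hz s x hx (fun ω => c ⬝ᵥ y ω) (y s) (hy s) (fun ω => hnonneg ω (y ω) (hy ω))
      (fun ω j => hcut ω j x hx (y ω) (hy ω) (hfeas ω)) le_rfl (hfeas s)
end
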